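/- Let n ≥ 2, 0 < ε < 1, K₀ ≥ 2, K ≥ 6K₀, ν := (9/2)n+2, α := √ε·K^ν, and γ := 11n+4. Then there exists a constant c > 1 depending only on n such that the Lebesgue measure of ℛ² satisfies meas ℛ² ≤ c·α²·K^{2n} = c·ε·K^γ. -/

import Mathlib

open MeasureTheory

noncomputable section

/-- The Euclidean norm `|y|` of `y ∈ ℝⁿ`. -/
def eNorm {n : ℕ} (y : Fin n → ℝ) : ℝ := Real.sqrt (∑ i, y i ^ 2)

/-- The Euclidean norm `|k|` of an integer vector `k ∈ ℤⁿ`. -/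
def eNormZ {n : ℕ} (k : Fin n → ℤ) : ℝ := Real.sqrt (∑ i, (k i : ℝ) ^ 2)

/-- `|k|₁ := ∑ᵢ |kᵢ|`, as a real number. -/
def norm1 {n : ℕ} (k : Fin n → ℤ) : ℝ := ∑ i, |(k i : ℝ)|

/-- `ℤⁿ_*`: nonzero integer vectors whose first nonzero component is positive. -/
def ZnStar {n : ℕ} (k : Fin n → ℤ) : Prop :=
  k ≠ 0 ∧ ∀ j, (∀ i, i < j → k i = 0) → 0 ≤ k j

/-- `𝒢ⁿ`: generators of one-dimensional maximal lattices, i.e. `k ∈ ℤⁿ_*` with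
`gcd (k₁, …, kₙ) = 1`. -/
def Gen {n : ℕ} (k : Fin n → ℤ) : Prop :=
  ZnStar k ∧ Finset.univ.gcd (fun i => (k i).natAbs) = 1

/-- `𝒢ⁿ_K := {k ∈ 𝒢ⁿ : |k|₁ ≤ K}`. -/
def GenK {n : ℕ} (K : ℝ) (k : Fin n → ℤ) : Prop := Gen k ∧ norm1 k ≤ K

/-- The dot product `y · k` of `y ∈ ℝⁿ` with an integer vector `k`. -/
def dotZ {n : ℕ} (y : Fin n → ℝ) (k : Fin n → ℤ) : ℝ := ∑ i, y i * (k i : ℝ)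

/-- The orthogonal projection `π_k^⊥ y := y − ((y·k)/|k|²) k` of `y` onto the orthogonal
complement of `k`. -/
def perpZ {n : ℕ} (y : Fin n → ℝ) (k : Fin n → ℤ) : Fin n → ℝ :=
  y - ((dotZ y k) / (∑ i, (k i : ℝ) ^ 2)) • fun i => (k i : ℝ)

/-- The open unit ball `𝔻 := {y ∈ ℝⁿ : |y| < 1}`. -/
def unitBall (n : ℕ) : Set (Fin n → ℝ) := {y | eNorm y < 1}

/-- The nonresonant set `ℛ⁰ := {y ∈ 𝔻 : |y·k| > α/2 ∀ k ∈ 𝒢ⁿ_{K₀}}`. -/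
def R0 (n : ℕ) (α K₀ : ℝ) : Set (Fin n → ℝ) :=
  {y | y ∈ unitBall n ∧ ∀ k : Fin n → ℤ, GenK K₀ k → α / 2 < |dotZ y k|}

/-- The simply-resonant set
`ℛ¹_k := {y ∈ 𝔻 : |y·k| < α, |π_k^⊥ y·ℓ| > 3αK/|k| ∀ ℓ ∈ 𝒢ⁿ_K \ ℤk}`. -/
def R1k (n : ℕ) (α K : ℝ) (k : Fin n → ℤ) : Set (Fin n → ℝ) :=
  {y | y ∈ unitBall n ∧ |dotZ y k| < α ∧
    ∀ ℓ : Fin n → ℤ, GenK K ℓ → (¬ ∃ m : ℤ, ℓ = m • k) →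
      3 * α * K / eNormZ k < |dotZ (perpZ y k) ℓ|}

/-- `ℛ¹ := ⋃_{k ∈ 𝒢ⁿ_{K₀}} ℛ¹_k`. -/
def R1 (n : ℕ) (α K₀ K : ℝ) : Set (Fin n → ℝ) :=
  ⋃ k ∈ {k : Fin n → ℤ | GenK K₀ k}, R1k n α K k

/-- The (neighborhood of) double resonances `ℛ² := 𝔻 \ (ℛ⁰ ∪ ℛ¹)`. -/
def R2 (n : ℕ) (α K₀ K : ℝ) : Set (Fin n → ℝ) :=
  unitBall n \ (R0 n α K₀ ∪ R1 n α K₀ K)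

end
open Matrix

theorem bezout {n : ℕ} (k : Fin n → ℤ) (h : Finset.univ.gcd (fun i => (k i).natAbs) = 1) :
    ∃ u : Fin n → ℤ, ∑ i, u i * k i = 1 := by
  rw [← Ideal.mem_span_range_iff_exists_fun]
  set I := Ideal.span (Set.range k) with hI
  have hd : ∀ i, Submodule.IsPrincipal.generator I ∣ k i := fun i => by
    rw [← Submodule.IsPrincipal.mem_iff_generator_dvd]
    exact Ideal.subset_span ⟨i, rfl⟩
  have h1 : (Submodule.IsPrincipal.generator I).natAbs ∣ 1 := by
    rw [← h]
    exact Finset.dvd_gcd fun i _ => Int.natAbs_dvd_natAbs.2 (hd i)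
  rw [Submodule.IsPrincipal.mem_iff_generator_dvd]
  simpa using Int.natAbs_dvd_natAbs.1 (by simpa using h1)

theorem exists_minor {n : ℕ} (k l : Fin n → ℤ) (h : Finset.univ.gcd (fun i => (k i).natAbs) = 1)
    (hl : ¬ ∃ m : ℤ, l = m • k) : ∃ i j, k i * l j - k j * l i ≠ 0 := by
  by_contra! hc
  obtain ⟨u, hu⟩ := bezout k h
  apply hl
  refine ⟨∑ i, u i * l i, ?_⟩
  ext j
  have : l j = (∑ i, u i * k i) * l j := by rw [hu, one_mul]
  rw [this, Pi.smul_apply, smul_eq_mul, Finset.sum_mul, Finset.sum_mul]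
  refine Finset.sum_congr rfl fun i _ => ?_
  linear_combination u i * hc i j

theorem det_two {n : ℕ} (i j : Fin n) (hij : i ≠ j) (a b : Fin n → ℝ) :
    (((1 : Matrix (Fin n) (Fin n) ℝ).updateRow i a).updateRow j b).det = a i * b j - a j * b i := by
  have : ((1 : Matrix (Fin n) (Fin n) ℝ).updateRow i a).updateRow j b =
      1 + (Matrix.of fun r => ![(Pi.single i 1 : Fin n → ℝ) r, (Pi.single j 1 : Fin n → ℝ) r]) *
        (Matrix.of ![a - Pi.single i 1, b - Pi.single j 1]) := by
    ext r s
    simp only [Matrix.add_apply, Matrix.mul_apply, Fin.sum_univ_two, Matrix.of_apply,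
      Matrix.updateRow_apply, Matrix.one_apply, Pi.single_apply, Pi.sub_apply, 
      Matrix.cons_val_zero, Matrix.cons_val_one]
    by_cases h1 : r = j
    · subst h1; simp [hij.symm, eq_comm]
    · by_cases h2 : r = i
      · subst h2; simp [h1, eq_comm]
      · simp [h1, h2]
  rw [this, Matrix.det_one_add_mul_comm, Matrix.det_fin_two]
  simp only [Matrix.add_apply, Matrix.mul_apply, Matrix.of_apply, Matrix.one_apply, Pi.single_apply, Pi.sub_apply, Matrix.cons_val_zero, Matrix.cons_val_one]
  simp [hij, hij.symm]

theorem vol_slab {n : ℕ} (i j : Fin n) (hij : i ≠ j) (a b : Fin n → ℝ) (s t : ℝ) (hs : 0 ≤ s)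
    (ht : 0 ≤ t) (hd : 1 ≤ |a i * b j - a j * b i|) :
    volume {y : Fin n → ℝ | (∀ m, |y m| ≤ 1) ∧ |∑ m, y m * a m| ≤ s ∧ |∑ m, y m * b m| ≤ t}
      ≤ ENNReal.ofReal (2 ^ n * s * t) := by
  set M := ((1 : Matrix (Fin n) (Fin n) ℝ).updateRow i a).updateRow j b with hM
  set r : Fin n → ℝ := Function.update (Function.update 1 i s) j t with hr
  have hdet : LinearMap.det (Matrix.toLin' M) = a i * b j - a j * b i := by
    rw [LinearMap.det_toLin', hM, det_two i j hij]
  have h0 : LinearMap.det (Matrix.toLin' M) ≠ 0 := by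
    rw [hdet]; intro h; rw [h] at hd; norm_num at hd
  have hsub : {y : Fin n → ℝ | (∀ m, |y m| ≤ 1) ∧ |∑ m, y m * a m| ≤ s ∧ |∑ m, y m * b m| ≤ t}
      ⊆ (Matrix.toLin' M) ⁻¹' (Set.Icc (-r) r) := by
    rintro y ⟨h1, h2, h3⟩
    have key : ∀ m, |Matrix.toLin' M y m| ≤ r m := by
      intro m
      rw [Matrix.toLin'_apply]
      by_cases hmj : m = j
      · subst hmj
        simpa [hr, hM, Matrix.mulVec, dotProduct, mul_comm] using h3
      · by_cases hmi : m = i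
        · subst hmi
          simpa [hr, hM, Matrix.mulVec, dotProduct, mul_comm, hmj, Matrix.updateRow_apply] using h2
        · have : (M *ᵥ y) m = ((1 : Matrix (Fin n) (Fin n) ℝ) *ᵥ y) m := by
            simp [hM, Matrix.mulVec, dotProduct, Matrix.updateRow_apply, hmj, hmi]
          rw [this, Matrix.one_mulVec]
          simpa [hr, hmj, hmi] using h1 m
    exact ⟨fun m => (abs_le.1 (key m)).1, fun m => (abs_le.1 (key m)).2⟩
  refine (measure_mono hsub).trans ?_
  rw [Measure.addHaar_preimage_linearMap _ h0, hdet, Real.volume_Icc_pi]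
  have hr0 : ∀ m, 0 ≤ r m := by
    intro m
    simp only [hr, Function.update_apply]
    split_ifs <;> simp [*]
  have hp : ∏ m, r m = s * t := by
    rw [hr, Finset.prod_update_of_mem (Finset.mem_univ j), 
      Finset.prod_update_of_mem (by simp [hij])]
    simp [mul_comm]
  rw [← ENNReal.ofReal_prod_of_nonneg (fun m _ => by simp [hr0 m])]
  rw [← ENNReal.ofReal_mul (abs_nonneg _)]
  apply ENNReal.ofReal_le_ofReal
  have : ∏ m, (r m - (-r) m) = 2 ^ n * (s * t) := by
    rw [← hp]
    simp only [Pi.neg_apply, sub_neg_eq_add, ← two_mul]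
    rw [Finset.prod_mul_distrib]; simp
  rw [this, abs_inv, ← mul_assoc (2^n)]
  exact mul_le_of_le_one_left (by positivity) (inv_le_one_of_one_le₀ hd)

theorem pow_diff (x y : ℝ) (hy : 0 ≤ y) (hxy : y ≤ x) (n : ℕ) :
    x ^ (n+1) - y ^ (n+1) ≤ (n+1) * (x - y) * x ^ n := by
  induction n with
  | zero => simp
  | succ n ih =>
    have h1 : y ^ (n+1) ≤ x ^ (n+1) := pow_le_pow_left₀ hy hxy _
    have h2 := mul_le_mul_of_nonneg_right ih (hy.trans hxy)
    have h3 := mul_le_mul_of_nonneg_left h1 (sub_nonneg.2 hxy)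
    push_cast
    calc x ^ (n+1+1) - y ^ (n+1+1) = (x^(n+1) - y^(n+1)) * x + (x - y) * y^(n+1) := by ring
      _ ≤ _ := add_le_add h2 h3
      _ = _ := by ring

theorem mem_box {n : ℕ} (N : ℕ) (k : Fin n → ℤ) :
    k ∈ Finset.Icc (fun _ => -(N:ℤ)) (fun _ => (N:ℤ)) ↔ ‖k‖ ≤ N := by
  rw [Finset.mem_Icc, pi_norm_le_iff_of_nonneg (by positivity), Pi.le_def, Pi.le_def,
    ← forall_and]
  refine forall_congr' fun i => ?_
  rw [Int.norm_eq_abs, abs_le]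
  norm_cast

theorem card_box' {n : ℕ} (N : ℕ) :
    (Finset.Icc (fun _ : Fin n => -(N:ℤ)) (fun _ => (N:ℤ))).card = (2 * N + 1) ^ n := by
  rw [Pi.card_Icc]
  simp only [Int.card_Icc, Finset.prod_const, Finset.card_univ, Fintype.card_fin]
  congr 1; omega

theorem sum_inv (p N : ℕ) :
    ∑ k ∈ Finset.Icc (fun _ : Fin (p+2) => -(N:ℤ)) (fun _ => (N:ℤ)), ‖k‖⁻¹
      ≤ 2 * (p + 2) * 3 ^ (p+1) * (N:ℝ) ^ (p+1) := by
  induction N with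
  | zero =>
    rw [Finset.sum_eq_zero]
    · positivity
    · intro k hk
      rw [mem_box] at hk
      have : ‖k‖ = 0 := le_antisymm (by simpa using hk) (norm_nonneg _)
      simp [this]
  | succ N ih =>
    have hs : Finset.Icc (fun _ : Fin (p+2) => -(N:ℤ)) (fun _ => (N:ℤ)) ⊆
        Finset.Icc (fun _ : Fin (p+2) => -((N+1 : ℕ):ℤ)) (fun _ => ((N+1 : ℕ):ℤ)) := by
      intro k hk
      rw [mem_box] at hk ⊢
      push_cast; linarith
    rw [← Finset.sum_sdiff hs]
    have hcard := Finset.card_sdiff_add_card_eq_card hs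
    rw [card_box', card_box'] at hcard
    set D := Finset.Icc (fun _ : Fin (p+2) => -((N+1 : ℕ):ℤ)) (fun _ => ((N+1 : ℕ):ℤ)) \
      Finset.Icc (fun _ : Fin (p+2) => -(N:ℤ)) (fun _ => (N:ℤ)) with hD
    have hDs : ∑ k ∈ D, ‖k‖⁻¹ ≤ D.card • ((N:ℝ)+1)⁻¹ := by
      apply Finset.sum_le_card_nsmul
      intro k hk
      rw [hD, Finset.mem_sdiff, mem_box N] at hk
      apply inv_anti₀ (by positivity)
      by_contra! hlt
      apply hk.2
      rw [pi_norm_le_iff_of_nonneg (by positivity)]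
      intro i
      have := (norm_le_pi_norm k i).trans_lt hlt
      rw [Int.norm_eq_abs] at this ⊢
      norm_cast at this ⊢
      omega
    have hc : (D.card : ℝ) ≤ (p+2) * 2 * (3 * ((N:ℝ)+1)) ^ (p+1) := by
      have h1 : (D.card : ℝ) = (2*((N:ℝ)+1)+1)^(p+2) - (2*(N:ℝ)+1)^(p+2) := by
        rw [eq_sub_iff_add_eq]; exact_mod_cast hcard
      rw [h1]
      refine (pow_diff _ _ (by positivity) (by linarith) (p+1)).trans ?_
      push_cast
      have : (2*((N:ℝ)+1)+1)^(p+1) ≤ (3 * ((N:ℝ)+1))^(p+1) := by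
        apply pow_le_pow_left₀ (by positivity)
        have : (0:ℝ) ≤ N := by positivity
        linarith
      calc _ = ((p:ℝ)+2) * 2 * (2*((N:ℝ)+1)+1)^(p+1) := by ring
        _ ≤ _ := by gcongr
    have hN : (0:ℝ) < (N:ℝ)+1 := by positivity
    have h2 : D.card • ((N:ℝ)+1)⁻¹ ≤ 2 * (p + 2) * 3 ^ (p+1) * ((N:ℝ)+1) ^ p := by
      rw [nsmul_eq_mul, ← div_eq_mul_inv, div_le_iff₀ hN]
      refine hc.trans (le_of_eq ?_)
      rw [mul_pow]; ring
    have h3 : (N:ℝ)^(p+1) + ((N:ℝ)+1)^p ≤ ((N:ℝ)+1)^(p+1) := by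
      have : (N:ℝ)^p ≤ ((N:ℝ)+1)^p := pow_le_pow_left₀ (by positivity) (by linarith) _
      have := mul_le_mul_of_nonneg_right this (Nat.cast_nonneg (α := ℝ) N)
      rw [pow_succ, pow_succ]; linarith
    push_cast
    have h4 := mul_le_mul_of_nonneg_left h3 (show (0:ℝ) ≤ 2 * (p + 2) * 3 ^ (p+1) by positivity)
    linarith

theorem dotZ_perp {n : ℕ} (y : Fin n → ℝ) (k l : Fin n → ℤ) :
    dotZ (perpZ y k) l = ∑ m, y m * ((l m : ℝ) -
      ((∑ i, (k i : ℝ) * l i) / (∑ i, (k i : ℝ) ^ 2)) * k m) := by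
  have h : ∀ c d : ℝ, (∑ m, (y m - (dotZ y k / d) * k m) * (l m : ℝ)) =
      ∑ m, y m * (l m : ℝ) - dotZ y k / d * ∑ i, (k i : ℝ) * l i := by
    intro c d
    rw [Finset.mul_sum, ← Finset.sum_sub_distrib]
    exact Finset.sum_congr rfl fun m _ => by ring
  have h2 : ∀ c : ℝ, (∑ m, y m * ((l m : ℝ) - c * k m)) =
      ∑ m, y m * (l m : ℝ) - c * dotZ y k := by
    intro c
    rw [dotZ, Finset.mul_sum, ← Finset.sum_sub_distrib]
    exact Finset.sum_congr rfl fun m _ => by ring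
  rw [h2]
  simp only [dotZ, perpZ, Pi.sub_apply, Pi.smul_apply, smul_eq_mul]
  simp only [dotZ] at h
  rw [h 0]
  ring

theorem norm_le_eNormZ {n : ℕ} (k : Fin n → ℤ) : ‖k‖ ≤ eNormZ k := by
  rw [eNormZ, pi_norm_le_iff_of_nonneg (Real.sqrt_nonneg _)]
  intro i
  rw [Int.norm_eq_abs]
  apply Real.abs_le_sqrt
  exact Finset.single_le_sum (f := fun i => (k i : ℝ) ^ 2) (fun i _ => sq_nonneg _)
    (Finset.mem_univ i)

theorem mem_box_of_norm1 {n : ℕ} (k : Fin n → ℤ) (K : ℝ) (hK : 0 ≤ K) (h : norm1 k ≤ K) :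
    k ∈ Finset.Icc (fun _ => -((⌊K⌋₊ : ℕ):ℤ)) (fun _ => ((⌊K⌋₊ : ℕ):ℤ)) := by
  rw [mem_box, pi_norm_le_iff_of_nonneg (by positivity)]
  intro i
  have h1 : |(k i : ℝ)| ≤ K := (Finset.single_le_sum (f := fun i => |(k i : ℝ)|)
    (fun i _ => abs_nonneg _) (Finset.mem_univ i)).trans h
  have h2 : (k i).natAbs ≤ ⌊K⌋₊ := by
    apply Nat.le_floor
    rwa [Nat.cast_natAbs, Int.cast_abs]
  rw [Int.norm_eq_abs, ← Int.cast_abs, ← Nat.cast_natAbs]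
  exact_mod_cast h2

theorem vol_pair {n : ℕ} (α K : ℝ) (hα : 0 ≤ α) (hK : 0 ≤ K) (k l : Fin n → ℤ) (hk : Gen k)
    (hl : ¬ ∃ m : ℤ, l = m • k) :
    volume {y : Fin n → ℝ | y ∈ unitBall n ∧ |dotZ y k| ≤ α / 2 ∧
      |dotZ (perpZ y k) l| ≤ 3 * α * K / eNormZ k} ≤
    ENNReal.ofReal (2 ^ n * (3 / 2) * α ^ 2 * K * ‖k‖⁻¹) := by
  obtain ⟨i, j, hm⟩ := exists_minor k l hk.2 hl
  have hij : i ≠ j := by rintro rfl; simp at hm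
  set c : ℝ := (∑ i, (k i : ℝ) * l i) / (∑ i, (k i : ℝ) ^ 2) with hc
  have hkn : 0 < ‖k‖ := norm_pos_iff.2 hk.1.1
  have he : 0 < eNormZ k := hkn.trans_le (norm_le_eNormZ k)
  have hd : 1 ≤ |(k i : ℝ) * ((l j : ℝ) - c * k j) - (k j : ℝ) * ((l i : ℝ) - c * k i)| := by
    have : (k i : ℝ) * ((l j : ℝ) - c * k j) - (k j : ℝ) * ((l i : ℝ) - c * k i) =
      ((k i * l j - k j * l i : ℤ) : ℝ) := by push_cast; ring
    rw [this]
    exact_mod_cast Int.one_le_abs hm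
  refine (measure_mono ?_).trans ((vol_slab i j hij (fun m => (k m : ℝ))
    (fun m => (l m : ℝ) - c * k m) (α / 2) (3 * α * K / eNormZ k) (by positivity)
    (by positivity) hd).trans ?_)
  · rintro y ⟨h1, h2, h3⟩
    refine ⟨fun m => ?_, h2, ?_⟩
    · refine le_trans ?_ (le_of_lt h1)
      apply Real.abs_le_sqrt
      exact Finset.single_le_sum (f := fun i => (y i) ^ 2) (fun i _ => sq_nonneg _)
        (Finset.mem_univ m)
    · rw [dotZ_perp] at h3
      exact h3
  · apply ENNReal.ofReal_le_ofReal
    have : (eNormZ k)⁻¹ ≤ ‖k‖⁻¹ := inv_anti₀ hkn (norm_le_eNormZ k)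
    calc _ = 2 ^ n * (3 / 2) * α ^ 2 * K * (eNormZ k)⁻¹ := by ring
      _ ≤ _ := by gcongr

theorem vol_R2 (p : ℕ) (α K₀ K : ℝ) (hα : 0 < α) (hK0 : 2 ≤ K₀) (hK : 6 * K₀ ≤ K) :
    volume (R2 (p+2) α K₀ K) ≤ ENNReal.ofReal
      ((2 ^ (p+2) * (3 / 2) * 3 ^ (p+2) * (2 * (p+2) * 3 ^ (p+1))) * α ^ 2 * K ^ (2 * (p+2))) := by
  classical
  have hKK : K₀ ≤ K := by linarith
  have hKpos : 0 ≤ K := by linarith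
  set B : ℕ → Finset (Fin (p+2) → ℤ) :=
    fun N => Finset.Icc (fun _ => -(N:ℤ)) (fun _ => (N:ℤ)) with hB
  set S := (B ⌊K₀⌋₊).filter (fun k => GenK K₀ k) with hS
  set T : (Fin (p+2) → ℤ) → Finset (Fin (p+2) → ℤ) :=
    fun k => (B ⌊K⌋₊).filter (fun l => ¬ ∃ m : ℤ, l = m • k) with hT
  have hsub : R2 (p+2) α K₀ K ⊆ ⋃ k ∈ S, ⋃ l ∈ T k,
      {y : Fin (p+2) → ℝ | y ∈ unitBall (p+2) ∧ |dotZ y k| ≤ α / 2 ∧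
      |dotZ (perpZ y k) l| ≤ 3 * α * K / eNormZ k} := by
    rintro y ⟨hy, hn⟩
    have h0 : y ∉ R0 (p+2) α K₀ := fun h => hn (Or.inl h)
    have h1 : y ∉ R1 (p+2) α K₀ K := fun h => hn (Or.inr h)
    simp only [R0, Set.mem_ofPred_eq, not_and, not_forall, not_lt] at h0
    obtain ⟨k, hk, hyk⟩ := h0 hy
    simp only [R1, Set.mem_iUnion, Set.mem_ofPred_eq, not_exists] at h1
    have h1k := h1 k hk
    have key : ∃ l, GenK K l ∧ (¬ ∃ m : ℤ, l = m • k) ∧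
        |dotZ (perpZ y k) l| ≤ 3 * α * K / eNormZ k := by
      by_contra! hcon
      exact h1k ⟨hy, by linarith, fun l hl hlk => hcon l hl (not_exists.1 hlk)⟩
    obtain ⟨l, hl, hlk, hyl⟩ := key
    simp only [Set.mem_iUnion]
    refine ⟨k, ?_, l, ?_, hy, hyk, hyl⟩
    · exact Finset.mem_filter.2 ⟨mem_box_of_norm1 k K₀ (by linarith) hk.2, hk⟩
    · exact Finset.mem_filter.2 ⟨mem_box_of_norm1 l K hKpos hl.2, hlk⟩
  set Q : ℝ := 2 ^ (p+2) * (3 / 2) * α ^ 2 * K with hQ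
  have hQ0 : 0 ≤ Q := by positivity
  have hcardT : ∀ k, ((T k).card : ℝ) ≤ (3 * K) ^ (p+2) := by
    intro k
    have h1 : (T k).card ≤ (2 * ⌊K⌋₊ + 1) ^ (p+2) := by
      rw [← card_box']; exact Finset.card_filter_le _ _
    have h2 : ((T k).card : ℝ) ≤ (2 * (⌊K⌋₊ : ℝ) + 1) ^ (p+2) := by exact_mod_cast h1
    refine h2.trans (pow_le_pow_left₀ (by positivity) ?_ _)
    have := Nat.floor_le hKpos
    linarith
  have hfl : (⌊K₀⌋₊ : ℝ) ≤ K := (Nat.floor_le (by linarith)).trans hKK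
  calc volume (R2 (p+2) α K₀ K)
      ≤ ∑ k ∈ S, ∑ l ∈ T k, ENNReal.ofReal (Q * ‖k‖⁻¹) := by
        refine (measure_mono hsub).trans ((measure_biUnion_finset_le _ _).trans ?_)
        refine Finset.sum_le_sum fun k hk => (measure_biUnion_finset_le _ _).trans ?_
        refine Finset.sum_le_sum fun l hl => ?_
        exact vol_pair α K hα.le hKpos k l (Finset.mem_filter.1 hk).2.1 (Finset.mem_filter.1 hl).2
    _ = ENNReal.ofReal (∑ k ∈ S, ∑ l ∈ T k, Q * ‖k‖⁻¹) := by
        rw [ENNReal.ofReal_sum_of_nonneg]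
        · refine Finset.sum_congr rfl fun k _ => ?_
          rw [ENNReal.ofReal_sum_of_nonneg]
          intro _ _; positivity
        · intro k _
          exact Finset.sum_nonneg fun _ _ => by positivity
    _ ≤ _ := by
        apply ENNReal.ofReal_le_ofReal
        calc ∑ k ∈ S, ∑ l ∈ T k, Q * ‖k‖⁻¹ ≤ ∑ k ∈ S, ((3 * K) ^ (p+2) * Q) * ‖k‖⁻¹ := by
              refine Finset.sum_le_sum fun k _ => ?_
              rw [Finset.sum_const, nsmul_eq_mul, mul_assoc ((3 * K) ^ (p+2))]
              exact mul_le_mul_of_nonneg_right (hcardT k) (mul_nonneg hQ0 (by positivity))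
          _ ≤ ∑ k ∈ B ⌊K₀⌋₊, ((3 * K) ^ (p+2) * Q) * ‖k‖⁻¹ := by
              apply Finset.sum_le_sum_of_subset_of_nonneg (Finset.filter_subset _ _)
              intro _ _ _; positivity
          _ ≤ ((3 * K) ^ (p+2) * Q) * (2 * (p + 2) * 3 ^ (p+1) * K ^ (p+1)) := by
              rw [← Finset.mul_sum]
              refine mul_le_mul_of_nonneg_left ((sum_inv p _).trans ?_) (by positivity)
              gcongr
          _ = _ := by rw [hQ, mul_pow]; ring

/-- For `n ≥ 2`, `0 < ε < 1`, `K₀ ≥ 2`, `K ≥ 6K₀`, `ν := (9/2)n+2`,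
`α := √ε·K^ν` and `γ := 11n+4`, there is a constant `c > 1` depending only on `n` with
`meas ℛ² ≤ c·α²·K^{2n} = c·ε·K^γ`. -/
theorem measure_R2_le {n : ℕ} (hn : 2 ≤ n) :
    ∃ c : ℝ, 1 < c ∧
      ∀ ε K₀ K : ℝ, 0 < ε → ε < 1 → 2 ≤ K₀ → 6 * K₀ ≤ K →
        volume (R2 n (Real.sqrt ε * K ^ ((9 : ℝ) / 2 * n + 2)) K₀ K)
            ≤ ENNReal.ofReal (c * (Real.sqrt ε * K ^ ((9 : ℝ) / 2 * n + 2)) ^ 2 * K ^ (2 * n)) ∧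
          c * (Real.sqrt ε * K ^ ((9 : ℝ) / 2 * n + 2)) ^ 2 * K ^ (2 * n)
            = c * ε * K ^ (11 * n + 4) := by
  obtain ⟨p, rfl⟩ : ∃ p, n = p + 2 := ⟨n - 2, by omega⟩
  set c₀ : ℝ := 2 ^ (p+2) * (3 / 2) * 3 ^ (p+2) * (2 * (p+2) * 3 ^ (p+1)) with hc₀
  have hc0 : 0 < c₀ := by positivity
  refine ⟨c₀ + 1, by linarith, ?_⟩
  intro ε K₀ K hε _ hK0 hK
  have hKpos : 0 < K := by linarith
  constructor
  · refine (vol_R2 p _ K₀ K (by positivity) hK0 hK).trans ?_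
    apply ENNReal.ofReal_le_ofReal
    gcongr
    linarith
  · rw [mul_pow, Real.sq_sqrt hε.le, ← Real.rpow_natCast (K ^ _) 2, ← Real.rpow_mul hKpos.le]
    have : ((9 : ℝ) / 2 * ((p + 2 : ℕ) : ℝ) + 2) * ((2 : ℕ) : ℝ) = ((9 * (p + 2) + 4 : ℕ) : ℝ) := by
      push_cast; ring
    rw [this, Real.rpow_natCast]
    ring
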